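/- Let $\mathfrak{g}$ be a semisimple Lie algebra over an algebraically closed field of characteristic zero with Cartan subalgebra $\mathfrak{h}$, root system $\Phi$ and simple roots $\{\alpha_i\}$. Let $h \in \mathfrak{h}$ be a dominant element with $\alpha_i(h) \in \{0,1,2\}$ for all $i$, and let $\mathfrak{g}[0]$ be the $0$-weight space of $\mathrm{ad}(h)$. Then the dimension of the centre of $\mathfrak{g}[0]$ equals the number of simple roots $\alpha_j$ with $\alpha_j(h) > 0$. -/

import Mathlib

/-- The `0`-weight space `𝔤[0]` of `ad(h)`, i.e. the kernel of `ad(h)`,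
as a Lie subalgebra of `L`. -/
def adKer (K L : Type*) [CommRing K] [LieRing L] [LieAlgebra K L] (h : L) :
    LieSubalgebra K L where
  carrier := {x : L | ⁅h, x⁆ = 0}
  add_mem' := by
    intro a b ha hb
    simp only [Set.mem_setOf_eq, lie_add] at *
    rw [ha, hb, add_zero]
  zero_mem' := by simp
  smul_mem' := by
    intro c x hx
    simp only [Set.mem_setOf_eq, lie_smul] at *
    rw [hx, smul_zero]
  lie_mem' := by
    intro x y hx hy
    simp only [Set.mem_setOf_eq] at *
    rw [leibniz_lie, hx, hy, zero_lie, lie_zero, add_zero]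

open LieAlgebra LieModule Module

/-- If a root `χ` vanishes at a point where all simple roots take nonnegative integral values,
then `χ` vanishes wherever all the simple roots vanishing at that point do. -/
lemma eq_zero_of_forall_simple_eq_zero {K ι H : Type*} [Field K] [CharZero K] [Fintype ι]
    {α : ι → H → K} {χ : H → K} {m : ι → ℤ}
    (hm : (∀ j, 0 ≤ m j) ∨ (∀ j, m j ≤ 0)) (hχ : χ = fun x => ∑ j, m j • α j x)
    {h z : H} (hdom : ∀ i, ∃ n : ℕ, α i h = n) (hz : ∀ i, α i h = 0 → α i z = 0)
    (hh : χ h = 0) : χ z = 0 := by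
  choose n hn using hdom
  have hsum : ∑ j, m j * n j = 0 := by
    have : ((∑ j, m j * n j : ℤ) : K) = 0 := by simpa [hχ, hn] using hh
    exact_mod_cast this
  have hterm (j : ι) : m j * n j = 0 := by
    rcases hm with hm | hm
    · exact (Finset.sum_eq_zero_iff_of_nonneg
        (fun j _ => mul_nonneg (hm j) (Int.natCast_nonneg _))).mp hsum j (Finset.mem_univ j)
    · exact (Finset.sum_eq_zero_iff_of_nonpos
        (fun j _ => mul_nonpos_of_nonpos_of_nonneg (hm j) (Int.natCast_nonneg _))).mp hsum j
        (Finset.mem_univ j)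
  rw [hχ]
  refine Finset.sum_eq_zero fun j _ => ?_
  rcases mul_eq_zero.mp (hterm j) with hj | hj
  · simp [hj]
  · rw [hz j (by rw [hn j]; exact_mod_cast hj), smul_zero]

/-- The common kernel of some members of a basis of the dual space has dimension equal to the
number of remaining members. -/
lemma finrank_dualCoannihilator_span_subfamily {K ι V : Type*} [Field K] [Fintype ι]
    [AddCommGroup V] [Module K V]
    [FiniteDimensional K V] {A : ι → Dual K V} (hA : LinearIndependent K A)
    (hcard : Fintype.card ι = finrank K V) (p : ι → Prop) :
    finrank K (Submodule.span K (Set.range fun i : {i // p i} => A i)).dualCoannihilator =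
      Nat.card {i // ¬ p i} := by
  classical
  have hspan := finrank_span_eq_card (hA.comp (Subtype.val : {i // p i} → ι)
    Subtype.val_injective)
  have hsum := Subspace.finrank_add_finrank_dualCoannihilator_eq
    (Submodule.span K (Set.range fun i : {i // p i} => A i))
  have hcompl := Fintype.card_subtype_compl p
  have hle := Fintype.card_subtype_le p
  rw [Nat.card_eq_fintype_card]
  change finrank K (Submodule.span K (Set.range fun i : {i // p i} => A i)) = _ at hspan
  omega

section Centre

variable {K L : Type*} [Field K] [LieRing L] [LieAlgebra K L]
  {H : LieSubalgebra K L} [H.IsCartanSubalgebra]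

/-- An element commuting with a Cartan subalgebra belongs to it. -/
lemma mem_cartan_of_forall_lie_eq_zero {z : L} (hz : ∀ y ∈ H, ⁅y, z⁆ = 0) : z ∈ H := by
  rw [← LieSubalgebra.IsCartanSubalgebra.self_normalizing (H := H),
    LieSubalgebra.mem_normalizer_iff']
  exact fun y hy => hz y hy ▸ H.zero_mem

variable [FiniteDimensional K L] [IsKilling K L]

lemma cartan_lie_eq_zero {x y : L} (hx : x ∈ H) (hy : y ∈ H) : ⁅x, y⁆ = 0 := by
  simpa using congrArg Subtype.val (trivial_lie_zero H H ⟨x, hx⟩ ⟨y, hy⟩)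

variable [CharZero K] [IsTriangularizable K H L]

/-- If every root vanishing at `h` vanishes at `z`, then `z` commutes with the kernel of
`ad h`. -/
lemma lie_eq_zero_of_forall_root {h z : H}
    (hz : ∀ χ : H → K, rootSpace H χ ≠ ⊥ → χ h = 0 → χ z = 0)
    {y : L} (hy : ⁅(h : L), y⁆ = 0) : ⁅(z : L), y⁆ = 0 := by
  classical
  have htop : y ∈ ⨆ χ : H → K, (rootSpace H χ).toSubmodule := by
    rw [LieSubmodule.iSup_toSubmodule_eq_top.mpr (iSup_genWeightSpace_eq_top K H L)]
    trivial
  obtain ⟨f, hf, rfl⟩ := (Submodule.mem_iSup_iff_exists_finsupp _ _).mp htop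
  have hlie (w : H) : ⁅(w : L), f.sum fun _ x => x⁆ = ∑ χ ∈ f.support, χ w • f χ := by
    rw [Finsupp.sum, lie_sum]
    exact Finset.sum_congr rfl fun χ _ => IsKilling.lie_eq_smul_of_mem_rootSpace (hf χ) w
  rw [hlie] at hy ⊢
  have hind := (iSupIndep_iff_finsetSum_eq_zero_imp_eq_zero _).mp
    (LieSubmodule.iSupIndep_toSubmodule.mpr (iSupIndep_genWeightSpace K H L)) f.support
    (fun χ => χ h • f χ) (fun χ _ => Submodule.smul_mem _ _ (hf χ)) hy
  refine Finset.sum_eq_zero fun χ hχ => ?_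
  have hfχ : f χ ≠ 0 := Finsupp.mem_support_iff.mp hχ
  rw [hz χ (fun hbot => hfχ (by simpa [hbot] using hf χ))
    ((smul_eq_zero.mp (hind χ hχ)).resolve_right hfχ), zero_smul]

/-- The centre of the kernel of `ad h` consists of the elements of the Cartan subalgebra at which
every root vanishing at `h` vanishes. -/
lemma mem_center_adKer_iff {h : H} {x : adKer K L (h : L)} :
    x ∈ center K (adKer K L (h : L)) ↔ ∃ z : H, (z : L) = x ∧
      ∀ χ : H → K, rootSpace H χ ≠ ⊥ → χ h = 0 → χ z = 0 := by
  rw [LieModule.mem_maxTrivSubmodule]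
  constructor
  · intro hx
    have hcomm (y : L) (hy : ⁅(h : L), y⁆ = 0) : ⁅y, (x : L)⁆ = 0 :=
      congrArg Subtype.val (hx ⟨y, hy⟩)
    have hxH : (x : L) ∈ H := mem_cartan_of_forall_lie_eq_zero fun y hy =>
      hcomm y (cartan_lie_eq_zero h.2 hy)
    refine ⟨⟨x, hxH⟩, rfl, fun χ hχ hχh => ?_⟩
    obtain ⟨e, he, he0⟩ := (Submodule.ne_bot_iff _).mp
      (mt (LieSubmodule.toSubmodule_eq_bot _).mp hχ)
    have hhe : ⁅(h : L), e⁆ = 0 := by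
      have := IsKilling.lie_eq_smul_of_mem_rootSpace he h
      rwa [hχh, zero_smul] at this
    have hxe := hcomm e hhe
    rw [← lie_skew, neg_eq_zero] at hxe
    have := IsKilling.lie_eq_smul_of_mem_rootSpace he ⟨x, hxH⟩
    exact (smul_eq_zero.mp (this.symm.trans hxe)).resolve_right he0
  · rintro ⟨z, hzx, hz⟩ ⟨y, hy⟩
    apply Subtype.ext
    change ⁅y, (x : L)⁆ = 0
    rw [← lie_skew, neg_eq_zero, ← hzx]
    exact lie_eq_zero_of_forall_root hz hy

end Centre

/-- Let `𝔤` be a semisimple Lie algebra over an algebraically closed field `K` of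
characteristic zero, with Cartan subalgebra `H`, root spaces `rootSpace H χ`, and simple roots
`α i` (linearly independent, in number equal to the rank, every root being a nonnegative or
nonpositive integral combination of them).  Let `h ∈ H` be dominant with `α i h ∈ {0, 1, 2}`
for all `i`, and let `𝔤[0]` be the `0`-weight space of `ad h`.  Then the dimension of the
centre of `𝔤[0]` equals the number of simple roots `αⱼ` with `αⱼ(h) > 0` (i.e. `αⱼ(h) ≠ 0`,
the labels lying in `{0,1,2}`). -/
theorem stmt0 (K : Type*) [Field K] [IsAlgClosed K] [CharZero K]
    (L : Type*) [LieRing L] [LieAlgebra K L] [FiniteDimensional K L]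
    [LieAlgebra.IsSemisimple K L]
    (H : LieSubalgebra K L) [H.IsCartanSubalgebra]
    (ι : Type*) [Fintype ι] (α : ι → H → K)
    (hroot : ∀ i, α i ≠ 0 ∧ LieAlgebra.rootSpace H (α i) ≠ ⊥)
    (hind : LinearIndependent K α)
    (hcard : Fintype.card ι = Module.finrank K H)
    (hall : ∀ χ : H → K, χ ≠ 0 → LieAlgebra.rootSpace H χ ≠ ⊥ →
      ∃ m : ι → ℤ, ((∀ j, 0 ≤ m j) ∨ (∀ j, m j ≤ 0)) ∧
        χ = fun x => ∑ j, m j • α j x)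
    (h : H)
    (hlab : ∀ i, α i h = 0 ∨ α i h = 1 ∨ α i h = 2) :
    Module.finrank K ↥(LieAlgebra.center K ↥(adKer K L (h : L))) =
      Nat.card {i : ι // α i h ≠ 0} := by
  have hdom (i : ι) : ∃ n : ℕ, α i h = n := by
    rcases hlab i with hi | hi | hi
    · exact ⟨0, by simp [hi]⟩
    · exact ⟨1, by simp [hi]⟩
    · exact ⟨2, by simp [hi]⟩
  let A (i : ι) : Dual K H := (⟨α i, (hroot i).2⟩ : Weight K H L).toLinear
  have hAind : LinearIndependent K A :=
    LinearIndependent.of_comp (LinearMap.ltoFun K H K K) hind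
  rw [← finrank_dualCoannihilator_span_subfamily hAind hcard (fun i => α i h = 0)]
  set W := (Submodule.span K
    (Set.range fun i : {i // α i h = 0} => A i)).dualCoannihilator with hW
  have hmemW (z : H) : z ∈ W ↔ ∀ χ : H → K, rootSpace H χ ≠ ⊥ → χ h = 0 → χ z = 0 := by
    have hmem : z ∈ W ↔ ∀ i, α i h = 0 → α i z = 0 := by
      rw [hW, ← SetLike.mem_coe, Submodule.coe_dualCoannihilator_span]
      simp only [Set.mem_ofPred_eq, Set.forall_mem_range, Subtype.forall]
      rfl
    rw [hmem]
    refine ⟨fun hz χ hχ hχh => ?_, fun hz i => hz _ (hroot i).2⟩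
    by_cases hχ0 : χ = 0
    · simp [hχ0]
    obtain ⟨m, hm, hχm⟩ := hall χ hχ0 hχ
    exact eq_zero_of_forall_simple_eq_zero hm hχm hdom hz hχh
  have hmap : (center K (adKer K L (h : L))).toSubmodule.map (adKer K L (h : L)).toSubmodule.subtype
      = W.map H.toSubmodule.subtype := by
    ext x
    simp only [Submodule.mem_map]
    constructor
    · rintro ⟨y, hy, rfl⟩
      obtain ⟨z, hzy, hz⟩ := mem_center_adKer_iff.mp hy
      exact ⟨z, (hmemW z).mpr hz, hzy⟩
    · rintro ⟨z, hz, rfl⟩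
      exact ⟨⟨z, cartan_lie_eq_zero h.2 z.2⟩,
        mem_center_adKer_iff.mpr ⟨z, rfl, (hmemW z).mp hz⟩, rfl⟩
  exact (Submodule.finrank_map_subtype_eq (adKer K L (h : L)).toSubmodule
    (center K (adKer K L (h : L))).toSubmodule).symm.trans
    ((congrArg (fun S : Submodule K L => finrank K S) hmap).trans
      (Submodule.finrank_map_subtype_eq H.toSubmodule W))
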